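/- arXiv:2407.03599 — 5 statements merged into one kernel-verified Lean document; each statement's English description precedes it below -/
import Mathlib

section
/- Let F be a finite field with q elements. Let B = Π_{i∈ι} K_i be a finite product of finite field extensions K_i of F, with norm N_{B/F}(x) = Π_i N_{K_i/F}(x_i). Let χ : Bˣ → ℂˣ be a group homomorphism, and for each i ∈ ι let χ_i : K_iˣ → ℂˣ be its restriction to the i-th component, i.e. χ_i(y) = χ(u_y) where u_y ∈ Bˣ has i-th coordinate y and all other coordinates 1. Then χ is trivial on the kernel of N_{B/F} (i.e. χ(x) = 1 for every x ∈ Bˣ with N_{B/F}(x) = 1) if and only if there exists a group homomorphism χ₀ : Fˣ → ℂˣ such that χ_i(y) = χ₀(N_{K_i/F}(y)) for every i ∈ ι and every y ∈ K_iˣ. -/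
open scoped Classical

/-- The norm of a finite product of algebras over `F`, as a homomorphism on unit groups. -/
noncomputable def unitsPiNorm (F : Type*) [Field F] {ι : Type*} [Fintype ι]
    (K : ι → Type*) [∀ i, Field (K i)] [∀ i, Algebra F (K i)] : (∀ i, K i)ˣ →* Fˣ :=
  ∏ i, (Units.map (Algebra.norm F)).comp (Units.map (Pi.evalMonoidHom K i))

theorem unitsPiNorm_apply (F : Type*) [Field F] {ι : Type*} [Fintype ι]
    (K : ι → Type*) [∀ i, Field (K i)] [∀ i, Algebra F (K i)] (x : (∀ i, K i)ˣ) :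
    unitsPiNorm F K x =
      ∏ i, Units.map (Algebra.norm F) (Units.map (Pi.evalMonoidHom K i) x) := by
  simp [unitsPiNorm, MonoidHom.finsetProd_apply]

theorem coe_unitsPiNorm (F : Type*) [Field F] {ι : Type*} [Fintype ι]
    (K : ι → Type*) [∀ i, Field (K i)] [∀ i, Algebra F (K i)] (x : (∀ i, K i)ˣ) :
    (unitsPiNorm F K x : F) = ∏ i, Algebra.norm F ((x : ∀ i, K i) i) := by
  simp [unitsPiNorm_apply]

theorem unitsPiNorm_mulSingle (F : Type*) [Field F] {ι : Type*} [Fintype ι]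
    (K : ι → Type*) [∀ i, Field (K i)] [∀ i, Algebra F (K i)] (i : ι) (y : (K i)ˣ) :
    unitsPiNorm F K (Units.map (MonoidHom.mulSingle K i) y) = Units.map (Algebra.norm F) y := by
  ext
  rw [coe_unitsPiNorm, Finset.prod_eq_single i]
  · simp
  · intro j _ hj
    simp [Pi.mulSingle_eq_of_ne hj]
  · simp

theorem prod_unitsMap_mulSingle {ι : Type*} [Fintype ι] {M : ι → Type*}
    [∀ i, CommMonoid (M i)] (x : (∀ i, M i)ˣ) :
    ∏ i, Units.map (MonoidHom.mulSingle M i) (Units.map (Pi.evalMonoidHom M i) x) = x := by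
  ext1
  simpa using Finset.univ_prod_mulSingle (x : ∀ i, M i)

/-- **Criterion for triviality on the norm-one subgroup.** A multiplicative character
`χ : Bˣ → ℂˣ` of `B = Π i, K i` is trivial on the kernel of the norm `N_{B/F}` if and only
if there is a character `χ₀ : Fˣ → ℂˣ` with `χ_i = χ₀ ∘ N_{K i/F}` for all `i`, where
`χ_i` is the restriction of `χ` to the `i`-th component. -/
theorem char_trivial_on_norm_one_iff
    (F : Type*) [Field F] [Fintype F] (q : ℕ) (hq : Fintype.card F = q)
    (ι : Type*) [Fintype ι]
    (K : ι → Type*) [∀ i, Field (K i)] [∀ i, Algebra F (K i)]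
    [∀ i, FiniteDimensional F (K i)] [∀ i, Fintype (K i)]
    (χ : (∀ i, K i)ˣ →* ℂˣ) :
    (∀ x : (∀ i, K i)ˣ, (∏ i, Algebra.norm F ((x : ∀ i, K i) i)) = 1 → χ x = 1) ↔
      ∃ χ₀ : Fˣ →* ℂˣ, ∀ i : ι, ∀ y : (K i)ˣ,
        χ (Units.map (MonoidHom.mulSingle K i) y) = χ₀ (Units.map (Algebra.norm F) y) := by
  constructor
  · intro h
    rcases isEmpty_or_nonempty ι with hι | ⟨⟨i₀⟩⟩
    · exact ⟨1, fun i => isEmptyElim i⟩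
    · have hN : Function.Surjective (unitsPiNorm F K) := fun a => by
        obtain ⟨y, hy⟩ := FiniteField.unitsMap_norm_surjective F (K i₀) a
        exact ⟨_, (unitsPiNorm_mulSingle F K i₀ y).trans hy⟩
      have hker : (unitsPiNorm F K).ker ≤ χ.ker := fun x hx => by
        refine h x ?_
        rw [← coe_unitsPiNorm, MonoidHom.mem_ker.mp hx, Units.val_one]
      refine ⟨(unitsPiNorm F K).liftOfSurjective hN ⟨χ, hker⟩, fun i y => ?_⟩
      rw [← unitsPiNorm_mulSingle F K i y]
      exact ((unitsPiNorm F K).liftOfRightInverse_comp_apply _ _ ⟨χ, hker⟩ _).symm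
  · rintro ⟨χ₀, h⟩ x hx
    have hNx : unitsPiNorm F K x = 1 := Units.ext (by rw [coe_unitsPiNorm, hx, Units.val_one])
    rw [← prod_unitsMap_mulSingle x, map_prod]
    simp_rw [h]
    rw [← map_prod, ← unitsPiNorm_apply, hNx, map_one]
end

section
/- Let F be a finite field with q elements of characteristic 2, let ψ₀ be a nontrivial additive character of 𝔽₂ = ZMod 2, and let ψ = ψ₀ ∘ Tr_{F/𝔽₂} : F → ℂ. Let χ₁, χ₂ : Fˣ → ℂˣ be group homomorphisms. Then Σ_{x ∈ Fˣ, x + x⁻¹ ≠ 0} χ₁(x)·χ₂(x⁻¹)·ψ((x + x⁻¹)⁻¹) = Σ_{x ∈ F, x ≠ 0, x ≠ 1} χ₁(x)·χ₂(x)⁻¹. (This is the exotic inverted Kloosterman sum EIK(F,1) for the split algebra B = F × F with χ = χ₁ × χ₂, since x₁x₂ = 1 forces x₂ = x₁⁻¹.) -/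
open scoped Classical

/-- The trace to the prime field is invariant under squaring in characteristic 2. -/
theorem trace_zmod_two_sq {F : Type*} [Field F] [Finite F] [Algebra (ZMod 2) F] (u : F) :
    Algebra.trace (ZMod 2) F (u ^ 2) = Algebra.trace (ZMod 2) F u := by
  have h := Algebra.trace_eq_of_algEquiv
    (FiniteField.frobeniusAlgEquivOfAlgebraic (ZMod 2) F) u
  simpa [FiniteField.coe_frobeniusAlgEquivOfAlgebraic, ZMod.card] using h

/-- Artin–Schreier elements have trace zero. -/
theorem trace_zmod_two_add_sq {F : Type*} [Field F] [Finite F] [Algebra (ZMod 2) F] (u : F) :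
    Algebra.trace (ZMod 2) F (u + u ^ 2) = 0 := by
  rw [map_add, trace_zmod_two_sq, CharTwo.add_self_eq_zero]

theorem add_inv_eq_zero_iff_of_charTwo {F : Type*} [Field F] [CharP F 2] {x : F} (hx : x ≠ 0) :
    x + x⁻¹ = 0 ↔ x = 1 := by
  rw [CharTwo.add_eq_zero, ← mul_eq_one_iff_eq_inv₀ hx, mul_self_eq_one_iff, CharTwo.neg_eq,
    or_self]

theorem inv_add_inv_of_charTwo {F : Type*} [Field F] [CharP F 2] {x : F} (hx : x ≠ 0)
    (hx1 : x ≠ 1) : (x + x⁻¹)⁻¹ = (x + 1)⁻¹ + (x + 1)⁻¹ ^ 2 := by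
  have h2 : (2 : F) = 0 := CharTwo.two_eq_zero
  have h1 : x + 1 ≠ 0 := by rwa [Ne, CharTwo.add_eq_zero]
  have h_frac : x + x⁻¹ = (x + 1) ^ 2 / x := by
    rw [CharTwo.add_sq]
    field_simp
  rw [h_frac, inv_div]
  field_simp
  linear_combination -h2

/-- **The exceptional exotic inverted Kloosterman sum in characteristic 2.**
For the split algebra `B = F × F` at `a = 1`, the exotic inverted Kloosterman sum
degenerates to a character sum:
`Σ_{x ∈ Fˣ, x + x⁻¹ ≠ 0} χ₁(x) χ₂(x⁻¹) ψ((x + x⁻¹)⁻¹) = Σ_{x ∈ Fˣ, x ≠ 1} χ₁(x) χ₂(x)⁻¹`. -/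
theorem exotic_inverted_kloosterman_char_two_exceptional
    (F : Type*) [Field F] [Fintype F] (q : ℕ) (hq : Fintype.card F = q)
    [CharP F 2] [Algebra (ZMod 2) F]
    (ψ₀ : AddChar (ZMod 2) ℂ) (hψ₀ : ψ₀ ≠ 1)
    (ψ : F → ℂ) (hψ : ∀ t : F, ψ t = ψ₀ (Algebra.trace (ZMod 2) F t))
    (χ₁ χ₂ : Fˣ →* ℂˣ) :
    (∑ x : Fˣ, if (x : F) + (x : F)⁻¹ ≠ 0
      then (χ₁ x : ℂ) * (χ₂ x⁻¹ : ℂ) * ψ (((x : F) + (x : F)⁻¹)⁻¹) else 0)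
      = ∑ x : Fˣ, if x ≠ 1 then (χ₁ x : ℂ) * ((χ₂ x : ℂ))⁻¹ else 0 := by
  refine Finset.sum_congr rfl fun x _ => ?_
  rcases eq_or_ne x 1 with rfl | hx
  · simp [CharTwo.add_self_eq_zero]
  · have hx1 : (x : F) ≠ 1 := by simpa using hx
    have hne : (x : F) + (x : F)⁻¹ ≠ 0 := by
      rwa [Ne, add_inv_eq_zero_iff_of_charTwo x.ne_zero]
    rw [if_pos hne, if_pos hx, hψ, inv_add_inv_of_charTwo x.ne_zero hx1,
      trace_zmod_two_add_sq, AddChar.map_zero_eq_one, mul_one, map_inv, Units.val_inv_eq_inv_val]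
end

section
/- Let n ≥ 1 and m ≥ 1 be integers with n + 1 ≤ 2m. In ℝ^{n+2}, let e_1, …, e_{n+2} be the standard basis vectors and set V_j = e_j for 1 ≤ j ≤ n+1, V_{n+2} = e_{n+2} − e_{n+1}, and V_{n+3} = m·e_{n+2} − (e_1 + ⋯ + e_n). Let Δ be the convex hull of {0, V_1, …, V_{n+3}}. Then the Lebesgue measure of Δ equals 2m/(n+2)!. -/
open MeasureTheory Set

/-- The corner simplex of size `r`: the points with nonnegative coordinates whose sum is at most
`r`. -/
def cornerSimplex (ι : Type*) [Fintype ι] (r : ℝ) : Set (ι → ℝ) :=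
  {y | (∀ i, 0 ≤ y i) ∧ ∑ i, y i ≤ r}

theorem convex_cornerSimplex (ι : Type*) [Fintype ι] (r : ℝ) :
    Convex ℝ (cornerSimplex ι r) := by
  intro x hx y hy a b ha hb hab
  refine ⟨fun i => ?_, ?_⟩
  · have := mul_nonneg ha (hx.1 i)
    have := mul_nonneg hb (hy.1 i)
    simp only [Pi.add_apply, Pi.smul_apply, smul_eq_mul]
    linarith
  · have h₁ := mul_le_mul_of_nonneg_left hx.2 ha
    have h₂ := mul_le_mul_of_nonneg_left hy.2 hb
    simp only [Pi.add_apply, Pi.smul_apply, smul_eq_mul, Finset.sum_add_distrib, ← Finset.mul_sum]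
    calc _ ≤ a * r + b * r := add_le_add h₁ h₂
      _ = r := by rw [← add_mul, hab, one_mul]

theorem isClosed_cornerSimplex (ι : Type*) [Fintype ι] (r : ℝ) :
    IsClosed (cornerSimplex ι r) := by
  simp only [cornerSimplex, ofPred_and, ofPred_forall]
  exact (isClosed_iInter fun i => isClosed_le continuous_const (continuous_apply i)).inter
    (isClosed_le (by fun_prop) continuous_const)

theorem volume_cornerSimplex (d : ℕ) {r : ℝ} (hr : 0 ≤ r) :
    volume (cornerSimplex (Fin d) r) = ENNReal.ofReal (r ^ d / d.factorial) := by
  induction d generalizing r with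
  | zero =>
    have : cornerSimplex (Fin 0) r = univ := by
      ext y
      simp [cornerSimplex, hr]
    simp [this, volume_pi]
  | succ d ih =>
    have hmp := (volume_preserving_piFinSuccAbove (fun _ : Fin (d + 1) => ℝ) 0).symm
    have hmeas := (isClosed_cornerSimplex (Fin (d + 1)) r).measurableSet
    rw [← hmp.measure_preimage hmeas.nullMeasurableSet, Measure.volume_eq_prod,
      Measure.prod_apply (hmp.measurable hmeas)]
    have hslice : ∀ x : ℝ, volume (Prod.mk x ⁻¹'
        ((MeasurableEquiv.piFinSuccAbove (fun _ : Fin (d + 1) => ℝ) 0).symm ⁻¹'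
          cornerSimplex (Fin (d + 1)) r)) =
        (Icc 0 r).indicator (fun x => ENNReal.ofReal ((r - x) ^ d / d.factorial)) x := by
      intro x
      have hmem : ∀ y : Fin d → ℝ, (MeasurableEquiv.piFinSuccAbove
          (fun _ : Fin (d + 1) => ℝ) 0).symm (x, y) ∈ cornerSimplex (Fin (d + 1)) r ↔
          0 ≤ x ∧ y ∈ cornerSimplex (Fin d) (r - x) := by
        intro y
        simp [cornerSimplex, MeasurableEquiv.piFinSuccAbove, Fin.forall_fin_succ, Fin.sum_univ_succ,
          and_assoc, le_sub_iff_add_le']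
      by_cases hx : x ∈ Icc 0 r
      · rw [indicator_of_mem hx, ← ih (sub_nonneg.2 hx.2)]
        congr 1
        ext y
        simp only [mem_preimage, hmem, hx.1, true_and]
      · rw [indicator_of_notMem hx]
        convert measure_empty (μ := volume)
        ext y
        simp only [mem_preimage, hmem, mem_empty_iff_false, iff_false]
        rintro ⟨h0, hy, hs⟩
        have := Finset.sum_nonneg fun i (_ : i ∈ Finset.univ) => hy i
        exact hx ⟨h0, by linarith⟩
    simp_rw [hslice]
    rw [lintegral_indicator measurableSet_Icc, ← ofReal_integral_eq_lintegral_ofReal]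
    · rw [integral_Icc_eq_integral_Ioc, ← intervalIntegral.integral_of_le hr,
        intervalIntegral.integral_div,
        intervalIntegral.integral_comp_sub_left (fun x => x ^ d) r]
      simp only [sub_self, sub_zero, integral_pow, Nat.factorial_succ, Nat.cast_mul, Nat.cast_succ]
      congr 1
      field_simp
      simp
    · exact (Continuous.continuousOn (by fun_prop)).integrableOn_Icc
    · filter_upwards [ae_restrict_mem measurableSet_Icc] with x hx
      have := sub_nonneg.2 hx.2
      simp only [Pi.zero_apply]
      positivity

theorem Convex.cornerSimplex_subset {ι : Type*} [Fintype ι] [DecidableEq ι] {s : Set (ι → ℝ)}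
    (hs : Convex ℝ s) (h0 : 0 ∈ s) (h1 : ∀ i, Pi.single i 1 ∈ s) : cornerSimplex ι 1 ⊆ s := by
  intro y hy
  have := hs.sum_mem (t := Finset.univ) (w := fun o : Option ι => o.elim (1 - ∑ i, y i) y)
    (z := fun o => o.elim 0 fun i => Pi.single i 1)
    (by rintro (_ | i) _
        · exact sub_nonneg.2 hy.2
        · exact hy.1 i)
    (by simp [Fintype.sum_option])
    (by rintro (_ | i) _
        · exact h0
        · exact h1 i)
  simpa [Fintype.sum_option, ← pi_eq_sum_univ'] using this

/-- If the `i`-th coordinate is nonnegative on `s` and nonpositive on `t`, and `t` is convex, then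
the volume of `s ∪ t` is the sum of the volumes. -/
theorem volume_union_of_coordinate {ι : Type*} [Fintype ι] {s t : Set (ι → ℝ)} (i : ι)
    (ht : Convex ℝ t) (hs0 : ∀ x ∈ s, 0 ≤ x i) (ht0 : ∀ x ∈ t, x i ≤ 0) :
    volume (s ∪ t) = volume s + volume t := by
  refine measure_union₀ (ht.nullMeasurableSet volume) ?_
  refine measure_mono_null (t := {x | x i = 0}) ?_ (Measure.pi_hyperplane _ i 0)
  exact fun x hx => le_antisymm (ht0 x hx.2) (hs0 x hx.1)

/-- **Volume of the Newton polytope, case `n + 1 ≤ 2m`.** The convex hull in `ℝ^{n+2}` of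
`0`, the standard basis vectors `e_1, …, e_{n+1}`, `e_{n+2} − e_{n+1}` and
`m·e_{n+2} − (e_1 + ⋯ + e_n)` has Lebesgue measure `2m/(n+2)!`. -/
theorem newton_polytope_volume_le
    (n m : ℕ) (hn : 1 ≤ n) (hm : 1 ≤ m) (h : n + 1 ≤ 2 * m) :
    MeasureTheory.volume (convexHull ℝ
      (({0} ∪ (Set.range fun j : Fin (n + 1) => Pi.single j.castSucc (1 : ℝ))
        ∪ {Pi.single (Fin.last (n + 1)) (1 : ℝ)
            - Pi.single (⟨n, by omega⟩ : Fin (n + 2)) (1 : ℝ)}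
        ∪ {Pi.single (Fin.last (n + 1)) ((m : ℝ))
            - ∑ i : Fin n, Pi.single (Fin.castLE (by omega) i) (1 : ℝ)})
        : Set (Fin (n + 2) → ℝ)))
      = ENNReal.ofReal (2 * m / (Nat.factorial (n + 2))) := by
  classical
  have hm0 : (0 : ℝ) < m := by exact_mod_cast hm
  have hnm : (n : ℝ) + 1 ≤ 2 * m := by exact_mod_cast h
  set L : Fin (n + 2) := Fin.last (n + 1) with hL
  set p : Fin (n + 2) := ⟨n, by omega⟩ with hp
  have hpc : p = (Fin.last n).castSucc := rfl
  have hLp : L ≠ p := by simp [hL, hp, Fin.ext_iff]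
  set V : Fin (n + 2) → ℝ := Pi.single L (m : ℝ)
    - ∑ i : Fin n, Pi.single (Fin.castLE (by omega) i) (1 : ℝ) with hV
  have hc : ∀ i : Fin n, (Fin.castLE (by omega) i : Fin (n + 2)) = i.castSucc.castSucc :=
    fun i => rfl
  have hVL : V L = m := by
    simp [hV, Finset.sum_apply, hc, hL]
  have hVp : V p = 0 := by
    simp [hV, Finset.sum_apply, hc, hpc, hL, Pi.single_apply, Fin.ext_iff]
    intro i; exact i.2.ne'
  have hVj : ∀ j : Fin n, V j.castSucc.castSucc = -1 := fun j => by
    simp [hV, Finset.sum_apply, hc, hL, Pi.single_apply, Fin.castSucc_ne_last]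
  set W : Fin (n + 2) → ℝ := Pi.single L 1 - Pi.single p 1 with hW
  set D := convexHull ℝ (({0} ∪ (Set.range fun j : Fin (n + 1) => Pi.single j.castSucc (1 : ℝ))
        ∪ {W} ∪ {V}) : Set (Fin (n + 2) → ℝ)) with hD
  set A : (Fin (n + 2) → ℝ) →ₗ[ℝ] (Fin (n + 2) → ℝ) :=
    LinearMap.transvection (LinearMap.proj L) (V - Pi.single L 1) with hA
  set R : (Fin (n + 2) → ℝ) →ₗ[ℝ] (Fin (n + 2) → ℝ) :=
    LinearMap.transvection (LinearMap.proj p) (W - Pi.single p 1) with hR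
  have hAdet : LinearMap.det A = m := by simp [hA, hVL]
  have hRdet : LinearMap.det R = -1 := by
    simp [hR, hW, hLp.symm]
  have hAx : ∀ x, A x = x + x L • (V - Pi.single L 1) := fun x => by
    simp [hA, LinearMap.transvection.apply]
  have hRx : ∀ x, R x = x + x p • (W - Pi.single p 1) := fun x => by
    simp [hR, LinearMap.transvection.apply]
  have hAp : ∀ x, A x p = x p := fun x => by simp [hAx, hVp, hLp.symm]
  have hRp : ∀ x, R x p = - x p := fun x => by simp [hRx, hW, hLp.symm]; ring
  have hAL : A (Pi.single L 1) = V := by simp [hAx]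
  have hAs : ∀ j, j ≠ L → A (Pi.single j 1) = Pi.single j 1 := fun j hj => by
    simp [hAx, hj.symm]
  have hRfix : ∀ x, x p = 0 → R x = x := fun x hx => by simp [hRx, hx]
  have hRe : R (Pi.single p 1) = W := by simp [hRx]
  have hRR : ∀ x, R (R x) = x := fun x => by
    rw [hRx (R x), hRp, hRx x]; module
  have hjL : ∀ j : Fin (n + 1), j.castSucc ≠ L := fun j => (Fin.castSucc_lt_last j).ne
  have hD0 : (0 : Fin (n + 2) → ℝ) ∈ D := subset_convexHull _ _ (by simp)
  have hDj : ∀ j : Fin (n + 1), Pi.single j.castSucc (1 : ℝ) ∈ D := fun j =>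
    subset_convexHull _ _ (Or.inl (Or.inl (Or.inr ⟨j, rfl⟩)))
  have hDW : W ∈ D := subset_convexHull _ _ (by simp)
  have hDV : V ∈ D := subset_convexHull _ _ (by simp)
  have hconv : Convex ℝ D := convex_convexHull _ _
  -- the two simplices lie in the polytope
  have hsub₁ : A '' cornerSimplex _ 1 ⊆ D := by
    rw [image_subset_iff]
    refine (hconv.linear_preimage A).cornerSimplex_subset (by simpa using hD0) fun i => ?_
    refine Fin.lastCases ?_ (fun j => ?_) i
    · simpa [← hL, hAL] using hDV
    · simpa [hAs _ (hjL j)] using hDj j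
  have hsub₂ : R '' (A '' cornerSimplex _ 1) ⊆ D := by
    rw [image_subset_iff, image_subset_iff]
    refine ((hconv.linear_preimage R).linear_preimage A).cornerSimplex_subset
      (by simpa using hD0) fun i => ?_
    refine Fin.lastCases ?_ (fun j => ?_) i
    · simpa [← hL, hAL, hRfix V hVp] using hDV
    · simp only [mem_preimage, hAs _ (hjL j)]
      by_cases hj : j.castSucc = p
      · rwa [hj, hRe]
      · rw [hRfix _ (by simp [Ne.symm hj])]
        exact hDj j
  -- the region where the sign of the `p`-th coordinate is not prescribed
  set S : Set (Fin (n + 2) → ℝ) := {y | (∀ i, i ≠ p → 0 ≤ y i) ∧ ∑ i, y i ≤ 1} with hS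
  have hSconv : Convex ℝ S := by
    intro x hx y hy a b ha hb hab
    refine ⟨fun i hi => ?_, ?_⟩
    · have := mul_nonneg ha (hx.1 i hi)
      have := mul_nonneg hb (hy.1 i hi)
      simp only [Pi.add_apply, Pi.smul_apply, smul_eq_mul]
      linarith
    · have h₁ := mul_le_mul_of_nonneg_left hx.2 ha
      have h₂ := mul_le_mul_of_nonneg_left hy.2 hb
      simp only [Pi.add_apply, Pi.smul_apply, smul_eq_mul, Finset.sum_add_distrib,
        ← Finset.mul_sum]
      linarith
  have hSs : ∀ j, Pi.single j (1 : ℝ) ∈ S := fun j =>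
    ⟨fun i _ => by by_cases hij : i = j <;> simp [hij], by simp⟩
  -- `W` in the coordinates of the first simplex
  obtain ⟨w, hwS, hwW⟩ : ∃ w ∈ S, A w = W := by
    refine ⟨fun j => if j = p then -1 else 1 / m, ⟨fun i hi => ?_, ?_⟩, ?_⟩
    · simp [hi]
    · simp [Fin.sum_univ_castSucc, hpc, Fin.ext_iff, (Fin.is_lt _).ne]
      field_simp
      linarith
    · ext j
      rw [hAx]
      refine Fin.lastCases ?_ (fun j => Fin.lastCases ?_ (fun j => ?_) j) j
      · simp [← hL, hVL, hW, hLp]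
        field_simp
        ring
      · simp only [← hpc, Pi.add_apply, Pi.smul_apply, Pi.sub_apply, hVp, hW]
        simp [hLp.symm]
      · have hjp : j.castSucc.castSucc ≠ p := by simp [hpc, Fin.castSucc_ne_last]
        simp only [Pi.add_apply, Pi.smul_apply, Pi.sub_apply, hVj, hW]
        simp [hLp, hjp, hjL]
  have hsup : D ⊆ A '' cornerSimplex _ 1 ∪ R '' (A '' cornerSimplex _ 1) := by
    have hDS : D ⊆ A '' S ∩ R '' (A '' S) := by
      refine convexHull_min ?_
        ((hSconv.linear_image A).inter ((hSconv.linear_image A).linear_image R))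
      have key : ∀ x ∈ A '' S, x p = 0 → x ∈ A '' S ∩ R '' (A '' S) := fun x hx h0 =>
        ⟨hx, x, hx, hRfix x h0⟩
      rintro x (((rfl | ⟨j, rfl⟩) | rfl) | rfl)
      · exact key 0 ⟨0, by simp [hS], map_zero A⟩ rfl
      · have hj : Pi.single j.castSucc 1 ∈ A '' S := ⟨_, hSs _, hAs _ (hjL j)⟩
        by_cases hjp : j.castSucc = p
        · refine ⟨hj, W, ⟨w, hwS, hwW⟩, ?_⟩
          simp only [hjp]
          rw [← hRe, hRR]
        · exact key _ hj (by simp [Ne.symm hjp])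
      · exact ⟨⟨w, hwS, hwW⟩, _, ⟨_, hSs p, hAs p hLp.symm⟩, hRe⟩
      · exact key _ ⟨_, hSs L, hAL⟩ hVp
    have hup : ∀ y ∈ S, 0 ≤ y p → y ∈ cornerSimplex (Fin (n + 2)) 1 := fun y hy h0 =>
      ⟨fun i => if hi : i = p then hi ▸ h0 else hy.1 i hi, hy.2⟩
    intro x hx
    obtain ⟨⟨y, hy, hyx⟩, _, ⟨z, hz, rfl⟩, hzx⟩ := hDS hx
    rcases le_total 0 (x p) with h0 | h0
    · exact Or.inl ⟨y, hup y hy (by rwa [← hAp y, hyx]), hyx⟩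
    · refine Or.inr ⟨_, ⟨z, hup z hz ?_, rfl⟩, hzx⟩
      rw [← hzx, hRp, hAp] at h0
      linarith
  rw [(hsup.antisymm (union_subset hsub₁ hsub₂)), volume_union_of_coordinate p
    (((convex_cornerSimplex _ 1).linear_image A).linear_image R)]
  · rw [Measure.addHaar_image_linearMap _ R, hRdet, abs_neg, abs_one,
      ENNReal.ofReal_one, one_mul, Measure.addHaar_image_linearMap, hAdet,
      volume_cornerSimplex _ zero_le_one, ← two_mul,
      ← ENNReal.ofReal_mul (abs_nonneg _), ← ENNReal.ofReal_ofNat 2,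
      ← ENNReal.ofReal_mul zero_le_two]
    congr 1
    rw [abs_of_pos hm0, one_pow]
    ring
  · rintro _ ⟨y, hy, rfl⟩
    rw [hAp]
    exact hy.1 p
  · rintro _ ⟨_, ⟨y, hy, rfl⟩, rfl⟩
    rw [hRp, hAp]
    exact neg_nonpos.2 (hy.1 p)
end

section
/- Let K be a field, let m ≥ 1 and n = 2m − 1, and assume the image of m in K is nonzero. Let w ∈ Kˣ and suppose x_1, …, x_n, x_{n+1}, x_{n+2} ∈ Kˣ satisfy the critical-point equations of the Laurent polynomial f̂ = x_{n+1} + x_{n+2}/x_{n+1} − (x_1 + ⋯ + x_n + w·x_{n+2}^m/(x_1⋯x_n)), namely: w·x_{n+2}^m/(x_1⋯x_n·x_i) = 1 for every 1 ≤ i ≤ n; x_{n+2}/x_{n+1}² = 1; and 1/x_{n+1} = m·w·x_{n+2}^{m−1}/(x_1⋯x_n). Then w = ((m : K)⁻¹)^{n+1}. -/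
/-- **Degenerate critical point in the boundary case `n + 1 = 2m`.** If the critical-point
equations of the Laurent polynomial
`f̂ = x_{n+1} + x_{n+2}/x_{n+1} − (x_1 + ⋯ + x_n + w·x_{n+2}^m/(x_1⋯x_n))`
have a solution with all coordinates nonzero, then `w = (m⁻¹)^{n+1}`. -/
theorem critical_point_forces_exceptional_parameter
    (K : Type*) [Field K] (m : ℕ) (hm : 1 ≤ m) (n : ℕ) (hn : n = 2 * m - 1)
    (hmK : (m : K) ≠ 0)
    (w : K) (hw : w ≠ 0)
    (x : Fin (n + 2) → K) (hx : ∀ j, x j ≠ 0)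
    (h1 : ∀ i : Fin n, w * (x (Fin.last (n + 1))) ^ m /
      ((∏ i' : Fin n, x (Fin.castLE (by omega) i')) * x (Fin.castLE (by omega) i)) = 1)
    (h2 : x (Fin.last (n + 1)) / (x (⟨n, by omega⟩ : Fin (n + 2))) ^ 2 = 1)
    (h3 : (x (⟨n, by omega⟩ : Fin (n + 2)))⁻¹ =
      (m : K) * w * (x (Fin.last (n + 1))) ^ (m - 1) /
        (∏ i' : Fin n, x (Fin.castLE (by omega) i'))) :
    w = ((m : K)⁻¹) ^ (n + 1) := by
  have hy : x ⟨n, by omega⟩ ≠ 0 := hx _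
  have hP : (∏ i' : Fin n, x (Fin.castLE (by omega) i')) ≠ 0 :=
    Finset.prod_ne_zero_iff.mpr fun _ _ => hx _
  have hz : x (Fin.last (n + 1)) = x ⟨n, by omega⟩ ^ 2 :=
    (div_eq_one_iff_eq (pow_ne_zero 2 hy)).mp h2
  rw [hz] at h1 h3
  generalize x ⟨n, by omega⟩ = y at *
  -- every `x_i` with `i ≤ n` equals the common value `c`, and `y = m * c`
  obtain ⟨c, hc⟩ : ∃ c, c = w * (y ^ 2) ^ m / ∏ i' : Fin n, x (Fin.castLE (by omega) i') :=
    ⟨_, rfl⟩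
  have hxc : ∀ i : Fin n, x (Fin.castLE (by omega) i) = c := fun i => by
    have hi := hx (Fin.castLE (by omega) i)
    have h := h1 i
    rw [div_eq_one_iff_eq (mul_ne_zero hP hi)] at h
    rw [hc, h, mul_div_cancel_left₀ _ hP]
  have hPc : (∏ i' : Fin n, x (Fin.castLE (by omega) i')) = c ^ n := by
    simp [hxc]
  rw [hPc] at hP hc h3
  obtain ⟨k, rfl⟩ : ∃ k, m = k + 1 := ⟨m - 1, by omega⟩
  obtain rfl : n = 2 * k + 1 := by omega
  have hc0 : c ≠ 0 := by
    rintro rfl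
    simp at hP
  have hyc : y = ((k + 1 : ℕ) : K) * c := by
    have h : y = y⁻¹ * y ^ 2 := by field_simp
    rw [h, h3, Nat.add_sub_cancel]
    conv_rhs => rw [hc]
    ring
  have hwc : w * y ^ (2 * k + 1 + 1) = c ^ (2 * k + 1 + 1) := by
    rw [eq_div_iff hP] at hc
    rw [pow_succ' c, hc]
    ring
  rw [hyc, mul_pow, ← mul_assoc] at hwc
  rw [inv_pow]
  exact eq_inv_of_mul_eq_one_left (mul_eq_right₀ (pow_ne_zero _ hc0) |>.mp hwc)
end

section
/- Let F be a finite field with q elements. Let B = Π_{i∈ι} K_i be a finite product of finite field extensions K_i of F, with trace Tr_{B/F}(x) = Σ_i Tr_{K_i/F}(x_i) and norm N_{B/F}(x) = Π_i N_{K_i/F}(x_i). Let χ : Bˣ → ℂˣ be a group homomorphism and ψ : F → ℂ a nontrivial additive character. Then for every a ∈ Fˣ, Σ_{x ∈ Bˣ, N_{B/F}(x) = a} Σ_{y ∈ Fˣ} Σ_{z ∈ F} χ(x)·ψ(y + z − y·z·Tr_{B/F}(x)) = q · Σ_{x ∈ Bˣ, Tr_{B/F}(x) ≠ 0, N_{B/F}(x)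 = a} χ(x)·ψ((Tr_{B/F}(x))⁻¹). -/
open scoped Classical

/-- For a nontrivial additive character `ψ` of a finite field, summing
`ψ (y + z - y * z * t)` over `z` localizes the sum over the units `y` at `y = t⁻¹`. -/
theorem AddChar.sum_units_sum_add_sub_mul {F : Type*} [Field F] [Fintype F]
    {ψ : AddChar F ℂ} (hψ : ψ ≠ 1) (t : F) :
    ∑ y : Fˣ, ∑ z : F, ψ ((y : F) + z - (y : F) * z * t) =
      if t ≠ 0 then (Fintype.card F : ℂ) * ψ t⁻¹ else 0 := by
  have hz (y : Fˣ) : ∑ z : F, ψ ((y : F) + z - (y : F) * z * t) =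
      if 1 - (y : F) * t = 0 then (Fintype.card F : ℂ) * ψ y else 0 := by
    have hsplit (z : F) : ψ ((y : F) + z - (y : F) * z * t) = ψ y * ψ (z * (1 - y * t)) := by
      rw [← AddChar.map_add_eq_mul]
      congr 1
      ring
    simp_rw [hsplit]
    rw [← Finset.mul_sum, AddChar.sum_mulShift _ (AddChar.IsPrimitive.of_ne_one hψ)]
    split_ifs <;> simp [mul_comm]
  simp_rw [hz]
  split_ifs with ht
  · rw [Finset.sum_eq_single (Units.mk0 t ht)⁻¹]
    · simp [ht]
    · intro y _ hy
      refine if_neg fun h => hy (Units.ext ?_)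
      simpa using eq_inv_of_mul_eq_one_left (sub_eq_zero.mp h).symm
    · simp
  · simp [not_not.mp ht]

/-- **Toric reduction of the exotic inverted Kloosterman sum.** Summing the additive
character over the auxiliary variables `y ∈ Fˣ`, `z ∈ F` recovers `q` times the exotic
inverted Kloosterman sum:
`Σ_{N(x)=a} Σ_{y∈Fˣ} Σ_{z∈F} χ(x) ψ(y + z − yz·Tr(x)) = q · EIK(F, a)`. -/
theorem exotic_inverted_kloosterman_toric_reduction
    (F : Type*) [Field F] [Fintype F] (q : ℕ) (hq : Fintype.card F = q)
    (ι : Type*) [Fintype ι]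
    (K : ι → Type*) [∀ i, Field (K i)] [∀ i, Algebra F (K i)]
    [∀ i, FiniteDimensional F (K i)] [∀ i, Fintype (K i)]
    [Fintype (∀ i, K i)ˣ]
    (χ : (∀ i, K i)ˣ →* ℂˣ)
    (ψ : AddChar F ℂ) (hψ : ψ ≠ 1)
    (a : Fˣ) :
    (∑ x : (∀ i, K i)ˣ,
      if (∏ i, Algebra.norm F ((x : ∀ i, K i) i)) = (a : F)
      then ∑ y : Fˣ, ∑ z : F,
        (χ x : ℂ) * ψ ((y : F) + z - (y : F) * z *
          (∑ i, Algebra.trace F (K i) ((x : ∀ i, K i) i)))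
      else 0)
      = (q : ℂ) * ∑ x : (∀ i, K i)ˣ,
          if (∑ i, Algebra.trace F (K i) ((x : ∀ i, K i) i)) ≠ 0 ∧
              (∏ i, Algebra.norm F ((x : ∀ i, K i) i)) = (a : F)
          then (χ x : ℂ) * ψ (∑ i, Algebra.trace F (K i) ((x : ∀ i, K i) i))⁻¹
          else 0 := by
  rw [Finset.mul_sum]
  refine Finset.sum_congr rfl fun x _ => ?_
  simp_rw [← Finset.mul_sum, AddChar.sum_units_sum_add_sub_mul hψ, hq, ite_and]
  split_ifs <;> ring
end
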